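/- Let A = ℚ[a₂, a₃] be the polynomial ring over ℚ in two indeterminates, let B = A[x]/(x³ + a₂x + a₃), which is free as an A-module with basis 1, x, x², and let π_! : B → A be the A-linear map taking the coefficient of x² in this basis. Then π_!((3x² − 2a₂)²) = −21a₂ and π_!((3x² − 2a₂)⁴) = 81a₃² − 609a₂³. Moreover, these two elements of A are algebraically independent over ℚ, and the ℚ-subalgebra of A they generate equals the ℚ-subalgebra generated by a₂ and a₃². -/

import Mathlib

/-!
Statement 16: with A = ℚ[a₂, a₃], B = A[x]/(x³ + a₂x + a₃) and π_! the
coefficient of x² in the basis 1, x, x², one has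
π_!((3x² − 2a₂)²) = −21a₂ and π_!((3x² − 2a₂)⁴) = 81a₃² − 609a₂³; these two
elements are algebraically independent over ℚ and generate the same
ℚ-subalgebra of A as a₂ and a₃².

Variables of `MvPolynomial (Fin 2) ℚ`: 0 = a₂, 1 = a₃.
-/

noncomputable section

open Polynomial

/-- A = ℚ[a₂, a₃]. -/
abbrev ARing : Type := MvPolynomial (Fin 2) ℚ

/-- a₂. -/ def a2 : ARing := MvPolynomial.X 0
/-- a₃. -/ def a3 : ARing := MvPolynomial.X 1

/-- The monic polynomial x³ + a₂x + a₃. -/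
def cubic : Polynomial ARing := X ^ 3 + C a2 * X + C a3

/-- π_! : B = A[x]/(x³ + a₂x + a₃) → A, extracting the coefficient of x² in the
basis 1, x, x²; computed on the canonical representative modulo the monic cubic. -/
def piShriek (g : Polynomial ARing) : ARing := (g %ₘ cubic).coeff 2

/-- The fiberwise first Pontryagin class p₁^{fw} = 3x² − 2a₂. -/
def p1fw : Polynomial ARing := 3 * X ^ 2 - C (2 * a2)

theorem cubic_natDegree : cubic.natDegree = 3 := by
  unfold cubic
  compute_degree!

theorem cubic_monic : cubic.Monic := by
  unfold cubic
  monicity!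

/-- If `g` is congruent to `b₂ x² + b₁ x + b₀` modulo the cubic, then `π_! g = b₂`. -/
theorem piShriek_eq_of_eq_add {g q : Polynomial ARing} {b₂ b₁ b₀ : ARing}
    (h : C b₂ * X ^ 2 + C b₁ * X + C b₀ + cubic * q = g) : piShriek g = b₂ := by
  have hdeg : (C b₂ * X ^ 2 + C b₁ * X + C b₀).degree < cubic.degree := by
    rw [degree_eq_natDegree cubic_monic.ne_zero, cubic_natDegree]
    exact degree_quadratic_lt
  rw [piShriek, (div_modByMonic_unique q _ cubic_monic ⟨h, hdeg⟩).2]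
  simp

theorem p1fw_sq_eq :
    C (-21 * a2) * X ^ 2 + C (-9 * a3) * X + C (4 * a2 ^ 2) + cubic * (9 * X) = p1fw ^ 2 := by
  simp only [cubic, p1fw, map_mul, map_neg, map_pow, map_ofNat]
  ring

theorem piShriek_p1fw_sq : piShriek (p1fw ^ 2) = -21 * a2 :=
  piShriek_eq_of_eq_add p1fw_sq_eq

theorem piShriek_p1fw_pow_four :
    piShriek (p1fw ^ 4) = 81 * a3 ^ 2 - 609 * a2 ^ 3 := by
  refine piShriek_eq_of_eq_add (b₁ := -891 * a2 ^ 2 * a3)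
    (b₀ := 16 * a2 ^ 4 - 378 * a2 * a3 ^ 2)
    (q := C (441 * a2 ^ 2) * X + C (378 * a2 * a3)
      + 18 * X * (C (-21 * a2) * X ^ 2 + C (-9 * a3) * X + C (4 * a2 ^ 2))
      + cubic * (9 * X) ^ 2) ?_
  rw [show p1fw ^ 4 = (p1fw ^ 2) ^ 2 by ring, ← p1fw_sq_eq]
  simp only [cubic, map_mul, map_neg, map_pow, map_ofNat, map_sub]
  ring

theorem algebraicIndependent_a2_a3_sq : AlgebraicIndependent ℚ ![a2, a3 ^ 2] := by
  have h := (MvPolynomial.algebraicIndependent_X (Fin 2) ℚ).polynomial_aeval_of_transcendental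
    (f := ![X, X ^ 2]) (by
      intro i
      fin_cases i
      · exact transcendental_X ℚ
      · exact (transcendental_X ℚ).pow two_pos)
  convert h using 1
  funext i
  fin_cases i <;> simp [a2, a3]

/-- The triangular substitution `(u, v) ↦ (-21 u, 81 v - 609 u³)` is injective. -/
theorem algebraicIndependent_triangular :
    AlgebraicIndependent ℚ ![-21 * a2, 81 * a3 - 609 * a2 ^ 3] := by
  rw [algebraicIndependent_iff_injective_aeval]
  let g : ARing →ₐ[ℚ] ARing := MvPolynomial.aeval
    ![MvPolynomial.C (-1 / 21) * a2,
      MvPolynomial.C (1 / 81) * (a3 + 609 * (MvPolynomial.C (-1 / 21) * a2) ^ 3)]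
  have h21 : (21 : ARing) * MvPolynomial.C (-1 / 21) = -1 := by
    rw [← map_ofNat MvPolynomial.C 21, ← map_mul]
    norm_num
  have h81 : (81 : ARing) * MvPolynomial.C (1 / 81) = 1 := by
    rw [← map_ofNat MvPolynomial.C 81, ← map_mul]
    norm_num
  have hg : g.comp (MvPolynomial.aeval ![-21 * a2, 81 * a3 - 609 * a2 ^ 3]) =
      AlgHom.id ℚ ARing := by
    have h2 : g a2 = MvPolynomial.C (-1 / 21) * a2 := by simp [g, a2]
    have h3 : g a3 =
        MvPolynomial.C (1 / 81) * (a3 + 609 * (MvPolynomial.C (-1 / 21) * a2) ^ 3) := by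
      simp [g, a3]
    refine MvPolynomial.algHom_ext fun i ↦ ?_
    fin_cases i
    · change g (MvPolynomial.aeval _ (MvPolynomial.X 0)) = a2
      rw [MvPolynomial.aeval_X]
      simp only [Matrix.cons_val_zero, map_mul, map_neg, map_ofNat, h2]
      linear_combination (-a2) * h21
    · change g (MvPolynomial.aeval _ (MvPolynomial.X 1)) = a3
      rw [MvPolynomial.aeval_X]
      simp only [Matrix.cons_val_one, Matrix.cons_val_fin_one, map_sub, map_mul, map_pow,
        map_ofNat, h2, h3]
      linear_combination (a3 + 609 * (MvPolynomial.C (-1 / 21) * a2) ^ 3) * h81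
  exact Function.LeftInverse.injective (g := g) fun p ↦ DFunLike.congr_fun hg p

theorem algebraicIndependent_kappa :
    AlgebraicIndependent ℚ ![-21 * a2, 81 * a3 ^ 2 - 609 * a2 ^ 3] := by
  convert algebraicIndependent_a2_a3_sq.aeval_of_algebraicIndependent
    algebraicIndependent_triangular using 1
  have h2 : MvPolynomial.aeval ![a2, a3 ^ 2] a2 = a2 := by simp [a2]
  have h3 : MvPolynomial.aeval ![a2, a3 ^ 2] a3 = a3 ^ 2 := by simp [a3]
  funext i
  fin_cases i
  · change -21 * a2 = MvPolynomial.aeval _ (-21 * a2)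
    rw [map_mul, map_neg, map_ofNat, h2]
  · change 81 * a3 ^ 2 - 609 * a2 ^ 3 = MvPolynomial.aeval _ (81 * a3 - 609 * a2 ^ 3)
    simp only [map_sub, map_mul, map_pow, map_ofNat, h2, h3]

theorem adjoin_kappa :
    Algebra.adjoin ℚ {-21 * a2, 81 * a3 ^ 2 - 609 * a2 ^ 3} =
      Algebra.adjoin ℚ {a2, a3 ^ 2} := by
  apply le_antisymm <;> rw [Algebra.adjoin_le_iff, Set.pair_subset_iff]
  · have h2 : a2 ∈ Algebra.adjoin ℚ {a2, a3 ^ 2} := Algebra.subset_adjoin (by simp)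
    have h3 : a3 ^ 2 ∈ Algebra.adjoin ℚ {a2, a3 ^ 2} := Algebra.subset_adjoin (by simp)
    exact ⟨mul_mem (neg_mem (ofNat_mem _ 21)) h2,
      sub_mem (mul_mem (ofNat_mem _ 81) h3) (mul_mem (ofNat_mem _ 609) (pow_mem h2 3))⟩
  · set S := Algebra.adjoin ℚ {-21 * a2, 81 * a3 ^ 2 - 609 * a2 ^ 3}
    have hu : -21 * a2 ∈ S := Algebra.subset_adjoin (by simp)
    have hv : 81 * a3 ^ 2 - 609 * a2 ^ 3 ∈ S := Algebra.subset_adjoin (by simp)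
    have h2 : a2 ∈ S := by
      convert S.smul_mem hu (-1 / 21 : ℚ) using 1
      rw [show (-21 : ARing) * a2 = (-21 : ℚ) • a2 by
        rw [MvPolynomial.smul_eq_C_mul, map_neg, map_ofNat], smul_smul]
      norm_num
    refine ⟨h2, ?_⟩
    convert S.smul_mem (add_mem hv (mul_mem (ofNat_mem S 609) (pow_mem h2 3))) (1 / 81 : ℚ) using 1
    rw [sub_add_cancel, show (81 : ARing) * a3 ^ 2 = (81 : ℚ) • a3 ^ 2 by
      rw [MvPolynomial.smul_eq_C_mul, map_ofNat], smul_smul]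
    norm_num

theorem stmt16 :
    piShriek (p1fw ^ 2) = -21 * a2 ∧
    piShriek (p1fw ^ 4) = 81 * a3 ^ 2 - 609 * a2 ^ 3 ∧
    AlgebraicIndependent ℚ ![piShriek (p1fw ^ 2), piShriek (p1fw ^ 4)] ∧
    Algebra.adjoin ℚ {piShriek (p1fw ^ 2), piShriek (p1fw ^ 4)} =
      Algebra.adjoin ℚ {a2, a3 ^ 2} := by
  rw [piShriek_p1fw_sq, piShriek_p1fw_pow_four]
  exact ⟨rfl, rfl, algebraicIndependent_kappa, adjoin_kappa⟩

end
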